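/- For the linearly oriented quiver Q of type A_{n−1}, if L is a degeneration of X (i.e. the orbit of L lies in the closure of the orbit of X in the representation variety), then the number of indecomposable direct summands of L is at least the number of indecomposable direct summands of X. -/

import Mathlib

/-!
Statement 17: for the linearly oriented quiver `Q : 1 → 2 → ⋯ → n-1` of type `A_{n-1}` over an
algebraically closed field, if `L` is a degeneration of `X` (the orbit of `L` lies in the
Zariski closure of the orbit of `X` in the representation variety `Rep b`), then the number of
indecomposable direct summands of `L` is at least that of `X`.  Numbers of summands are
recorded via decompositions of `X` and `L` into lists of indecomposable representations.
-/

/-- The Zariski topology on the affine space `σ → K`, induced from `Spec K[Xₛ : s ∈ σ]`. -/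
noncomputable def zariskiTopology (σ K : Type*) [Field K] : TopologicalSpace (σ → K) :=
  TopologicalSpace.induced
    (fun x => (⟨RingHom.ker (MvPolynomial.eval x), RingHom.ker_isPrime _⟩ :
      PrimeSpectrum (MvPolynomial σ K))) inferInstance

variable {nv ne : ℕ}

/-- A point of the representation variety of the quiver `(s, t)` with dimension vector `b`:
a matrix entry for each arrow `e` and each pair of coordinates. -/
def RepPt (s t : Fin ne → Fin nv) (b : Fin nv → ℕ) (K : Type u) : Type u :=
  ((e : Fin ne) × (Fin (b (t e)) × Fin (b (s e)))) → K

noncomputable instance (s t : Fin ne → Fin nv) (b : Fin nv → ℕ) (K : Type*) [Field K] :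
    TopologicalSpace (RepPt s t b K) :=
  zariskiTopology _ K

/-- The matrix of a representation point at an arrow `e`. -/
def repMat {s t : Fin ne → Fin nv} {b : Fin nv → ℕ} {K : Type*} (ρ : RepPt s t b K)
    (e : Fin ne) : Matrix (Fin (b (t e))) (Fin (b (s e))) K :=
  Matrix.of fun p q => ρ ⟨e, (p, q)⟩

/-- `φ` is a homomorphism of representations `ρ → ρ'`. -/
def IsRepHom {s t : Fin ne → Fin nv} {b c : Fin nv → ℕ} {K : Type*} [Field K]
    (ρ : RepPt s t b K) (ρ' : RepPt s t c K)
    (φ : ∀ i, Matrix (Fin (c i)) (Fin (b i)) K) : Prop :=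
  ∀ e, φ (t e) * repMat ρ e = repMat ρ' e * φ (s e)

/-- `φ` is an isomorphism of representations `ρ → ρ'`. -/
def IsRepIso {s t : Fin ne → Fin nv} {b c : Fin nv → ℕ} {K : Type*} [Field K]
    (ρ : RepPt s t b K) (ρ' : RepPt s t c K)
    (φ : ∀ i, Matrix (Fin (c i)) (Fin (b i)) K) : Prop :=
  IsRepHom ρ ρ' φ ∧ ∀ i, Function.Bijective (φ i).mulVecLin

/-- The isomorphism class (= `GL(b)`-orbit) of a representation point. -/
def isoClass {s t : Fin ne → Fin nv} {b : Fin nv → ℕ} {K : Type*} [Field K]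
    (ρ : RepPt s t b K) : Set (RepPt s t b K) :=
  {ρ' | ∃ φ, IsRepIso ρ ρ' φ}

/-- A representation together with its dimension vector. -/
def RepSig (s t : Fin ne → Fin nv) (K : Type u) : Type u :=
  Σ b : Fin nv → ℕ, RepPt s t b K

/-- Direct sum of two representation points (block-diagonal matrices). -/
def dsum₂ {s t : Fin ne → Fin nv} {b c : Fin nv → ℕ} {K : Type*} [Field K]
    (X : RepPt s t b K) (Y : RepPt s t c K) : RepPt s t (fun i => b i + c i) K :=
  fun x =>
    match finSumFinEquiv.symm x.2.1, finSumFinEquiv.symm x.2.2 with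
    | Sum.inl p, Sum.inl q => X ⟨x.1, (p, q)⟩
    | Sum.inr p, Sum.inr q => Y ⟨x.1, (p, q)⟩
    | _, _ => 0

/-- The zero representation. -/
def zeroRep (s t : Fin ne → Fin nv) (K : Type*) [Field K] :
    RepPt s t (fun _ => 0) K := fun _ => 0

/-- Direct sum of a pair of representations-with-dimension-vectors. -/
def dsumSig {s t : Fin ne → Fin nv} {K : Type*} [Field K] (X Y : RepSig s t K) :
    RepSig s t K :=
  Sigma.mk (fun i => X.1 i + Y.1 i) (dsum₂ X.2 Y.2)

/-- Direct sum of a list of representations. -/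
def dsumList {s t : Fin ne → Fin nv} {K : Type*} [Field K] (l : List (RepSig s t K)) :
    RepSig s t K :=
  l.foldr dsumSig (Sigma.mk (fun _ => 0) (zeroRep s t K))

/-- A representation is indecomposable if it is nonzero and admits no splitting into two
nonzero direct summands. -/
def IsIndec {s t : Fin ne → Fin nv} {K : Type*} [Field K] (X : RepSig s t K) : Prop :=
  X.1 ≠ (fun _ => 0) ∧
    ∀ Y Z : RepSig s t K, (∃ φ, IsRepIso X.2 (dsum₂ Y.2 Z.2) φ) →
      Y.1 = (fun _ => 0) ∨ Z.1 = (fun _ => 0)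

section helpers

variable {K : Type*} [Field K]

lemma exists_split_idem {n : ℕ} (E : Matrix (Fin n) (Fin n) K) (hE : E * E = E) :
    ∃ (a : ℕ) (ι : Matrix (Fin n) (Fin a) K) (π : Matrix (Fin a) (Fin n) K),
      ι * π = E ∧ π * ι = 1 := by
  classical
  let f := Matrix.toLin' E
  have hf : ∀ x, f (f x) = f x := fun x => by
    simp [f, Matrix.toLin'_apply, Matrix.mulVec_mulVec, hE]
  let B := Module.finBasis K (LinearMap.range f)
  refine ⟨_, LinearMap.toMatrix B (Pi.basisFun K (Fin n)) (LinearMap.range f).subtype,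
    LinearMap.toMatrix (Pi.basisFun K (Fin n)) B f.rangeRestrict, ?_, ?_⟩
  · rw [← LinearMap.toMatrix_comp]
    have : (LinearMap.range f).subtype ∘ₗ f.rangeRestrict = f := by ext; simp
    rw [this, LinearMap.toMatrix_eq_toMatrix']
    simp [f]
  · rw [← LinearMap.toMatrix_comp]
    have : f.rangeRestrict ∘ₗ (LinearMap.range f).subtype = LinearMap.id := by
      ext ⟨x, y, rfl⟩ : 2
      simp [hf]
    rw [this, LinearMap.toMatrix_id]

variable {s t : Fin ne → Fin nv}

lemma repMat_dsum₂ {b c : Fin nv → ℕ} (X : RepPt s t b K) (Y : RepPt s t c K) (e : Fin ne) :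
    repMat (dsum₂ X Y) e = (Matrix.fromBlocks (repMat X e) 0 0 (repMat Y e)).submatrix
      finSumFinEquiv.symm finSumFinEquiv.symm := by
  ext p q
  simp only [repMat, dsum₂, Matrix.of_apply, Matrix.submatrix_apply]
  rcases finSumFinEquiv.symm p with p | p <;> rcases finSumFinEquiv.symm q with q | q <;> rfl

lemma indec_idem (X : RepSig s t K) (hX : IsIndec X)
    (E : ∀ i, Matrix (Fin (X.1 i)) (Fin (X.1 i)) K) (hE : ∀ i, E i * E i = E i)
    (hc : ∀ e, E (t e) * repMat X.2 e = repMat X.2 e * E (s e)) :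
    (∀ i, E i = 0) ∨ (∀ i, E i = 1) := by
  choose a ι π h1 h2 using fun i => exists_split_idem (E i) (hE i)
  have hE' : ∀ i, (1 - E i) * (1 - E i) = 1 - E i := fun i => by
    simp [sub_mul, mul_sub, hE]
  choose c ι' π' h1' h2' using fun i => exists_split_idem (1 - E i) (hE' i)
  have hπ : ∀ i, π i * E i = π i := fun i => by
    rw [← h1, ← Matrix.mul_assoc, h2, Matrix.one_mul]
  have hπ' : ∀ i, π' i * (1 - E i) = π' i := fun i => by
    rw [← h1', ← Matrix.mul_assoc, h2', Matrix.one_mul]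
  have hι : ∀ i, E i * ι i = ι i := fun i => by
    rw [← h1, Matrix.mul_assoc, h2, Matrix.mul_one]
  have hι' : ∀ i, (1 - E i) * ι' i = ι' i := fun i => by
    rw [← h1', Matrix.mul_assoc, h2', Matrix.mul_one]
  have h12 : ∀ i, π i * ι' i = 0 := fun i => by
    rw [← hπ, ← hι', ← Matrix.mul_assoc, Matrix.mul_assoc (π i)]
    simp [mul_sub, hE]
  have h21 : ∀ i, π' i * ι i = 0 := fun i => by
    rw [← hπ', ← hι, ← Matrix.mul_assoc, Matrix.mul_assoc (π' i)]
    simp [sub_mul, hE]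
  let Y : RepSig s t K := ⟨a, fun x => (π (t x.1) * repMat X.2 x.1 * ι (s x.1)) x.2.1 x.2.2⟩
  let Z : RepSig s t K := ⟨c, fun x => (π' (t x.1) * repMat X.2 x.1 * ι' (s x.1)) x.2.1 x.2.2⟩
  have hY : ∀ e, repMat Y.2 e = π (t e) * repMat X.2 e * ι (s e) := fun e => rfl
  have hZ : ∀ e, repMat Z.2 e = π' (t e) * repMat X.2 e * ι' (s e) := fun e => rfl
  have key := hX.2 Y Z ⟨fun i => (Matrix.fromRows (π i) (π' i)).submatrix finSumFinEquiv.symm id, ?_, ?_⟩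
  · rcases key with k | k
    · left
      intro i
      have : a i = 0 := congrFun k i
      rw [← h1]
      ext p q
      rw [Matrix.mul_apply]
      have : IsEmpty (Fin (a i)) := by rw [this]; infer_instance
      simp
    · right
      intro i
      have : c i = 0 := congrFun k i
      have h0 : 1 - E i = 0 := by
        rw [← h1']
        ext p q
        rw [Matrix.mul_apply]
        have : IsEmpty (Fin (c i)) := by rw [this]; infer_instance
        simp
      exact (sub_eq_zero.mp h0).symm
  · intro e
    rw [repMat_dsum₂, hY, hZ]
    have e1 : π (t e) * repMat X.2 e * ι (s e) * π (s e) = π (t e) * repMat X.2 e := by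
      rw [Matrix.mul_assoc _ (ι _), h1, Matrix.mul_assoc, ← hc, ← Matrix.mul_assoc, hπ]
    have hc' : repMat X.2 e * (1 - E (s e)) = (1 - E (t e)) * repMat X.2 e := by
      rw [Matrix.mul_sub, Matrix.sub_mul, hc]; simp
    have e2 : π' (t e) * repMat X.2 e * ι' (s e) * π' (s e) = π' (t e) * repMat X.2 e := by
      rw [Matrix.mul_assoc _ (ι' _), h1', Matrix.mul_assoc, hc', ← Matrix.mul_assoc, hπ']
    rw [Matrix.submatrix_mul_equiv, Matrix.fromBlocks_mul_fromRows, e1, e2]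
    simp only [Matrix.zero_mul, add_zero, zero_add]
    rw [← Matrix.fromRows_mul]
    rfl
  · intro i
    have hl : (Matrix.fromCols (ι i) (ι' i)).submatrix id finSumFinEquiv.symm *
        (Matrix.fromRows (π i) (π' i)).submatrix finSumFinEquiv.symm id = 1 := by
      rw [Matrix.submatrix_mul_equiv, Matrix.fromCols_mul_fromRows, h1, h1']
      simp
    have hr : (Matrix.fromRows (π i) (π' i)).submatrix finSumFinEquiv.symm id *
        (Matrix.fromCols (ι i) (ι' i)).submatrix id finSumFinEquiv.symm = 1 := by
      have := Matrix.submatrix_mul_equiv (Matrix.fromRows (π i) (π' i))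
        (Matrix.fromCols (ι i) (ι' i)) finSumFinEquiv.symm (Equiv.refl _) finSumFinEquiv.symm
      rw [Matrix.fromRows_mul_fromCols, h2, h2', h12, h21, Matrix.fromBlocks_one,
        Matrix.submatrix_one_equiv] at this
      exact this
    constructor
    · apply Function.LeftInverse.injective (g := Matrix.mulVecLin
        ((Matrix.fromCols (ι i) (ι' i)).submatrix id finSumFinEquiv.symm))
      intro x
      simp only [Matrix.mulVecLin_apply, Matrix.mulVec_mulVec]
      rw [hl, Matrix.one_mulVec]
    · apply Function.RightInverse.surjective (g := Matrix.mulVecLin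
        ((Matrix.fromCols (ι i) (ι' i)).submatrix id finSumFinEquiv.symm))
      intro x
      simp only [Matrix.mulVecLin_apply, Matrix.mulVec_mulVec]
      rw [hr, Matrix.one_mulVec]

/-- The dimension of the top. -/
noncomputable def topZ {b : Fin nv → ℕ} (X : RepPt s t b K) : ℤ :=
  ∑ i, (b i : ℤ) - ∑ e, ((repMat X e).rank : ℤ)

lemma dim_of_iso {b c : Fin nv → ℕ} {X : RepPt s t b K} {Y : RepPt s t c K}
    {φ} (h : IsRepIso X Y φ) (i : Fin nv) : b i = c i := by
  have := (LinearEquiv.ofBijective _ (h.2 i)).finrank_eq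
  simpa using this

lemma rank_of_iso {b c : Fin nv → ℕ} {X : RepPt s t b K} {Y : RepPt s t c K}
    {φ} (h : IsRepIso X Y φ) (e : Fin ne) : (repMat X e).rank = (repMat Y e).rank := by
  have h1 := congrArg Matrix.mulVecLin (h.1 e)
  rw [Matrix.mulVecLin_mul, Matrix.mulVecLin_mul] at h1
  have h2 := congrArg LinearMap.range h1
  rw [LinearMap.range_comp, LinearMap.range_comp,
    LinearMap.range_eq_top.mpr (h.2 (s e)).2, Submodule.map_top] at h2
  unfold Matrix.rank
  rw [← h2]
  exact (Submodule.equivMapOfInjective _ (h.2 (t e)).1 _).finrank_eq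

lemma topZ_of_iso {b c : Fin nv → ℕ} {X : RepPt s t b K} {Y : RepPt s t c K}
    {φ} (h : IsRepIso X Y φ) : topZ X = topZ Y := by
  unfold topZ
  simp only [dim_of_iso h, rank_of_iso h]

lemma rank_fromBlocks_diag {m₁ m₂ n₁ n₂ : Type*} [Fintype m₁] [Fintype m₂] [Fintype n₁]
    [Fintype n₂] (A : Matrix m₁ n₁ K) (B : Matrix m₂ n₂ K) :
    (Matrix.fromBlocks A 0 0 B).rank = A.rank + B.rank := by
  let e1 := LinearEquiv.sumArrowLequivProdArrow n₁ n₂ K K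
  let e2 := LinearEquiv.sumArrowLequivProdArrow m₁ m₂ K K
  have h : (Matrix.fromBlocks A 0 0 B).mulVecLin =
      e2.symm.toLinearMap ∘ₗ (A.mulVecLin.prodMap B.mulVecLin) ∘ₗ e1.toLinearMap := by
    refine LinearMap.ext fun x => ?_
    apply e2.injective
    simp only [LinearMap.comp_apply, LinearEquiv.coe_coe, LinearEquiv.apply_symm_apply]
    rw [Matrix.mulVecLin_apply, Matrix.fromBlocks_mulVec]
    ext <;> simp [e1, e2] <;> rfl
  unfold Matrix.rank
  rw [h, LinearMap.range_comp, LinearMap.range_comp, LinearEquiv.range, Submodule.map_top,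
    LinearMap.range_prodMap]
  rw [LinearEquiv.finrank_map_eq]
  rw [← Module.finrank_prod]
  exact LinearEquiv.finrank_eq
    { toFun := fun x => (⟨x.1.1, x.2.1⟩, ⟨x.1.2, x.2.2⟩)
      invFun := fun x => ⟨(x.1.1, x.2.1), x.1.2, x.2.2⟩
      map_add' := fun _ _ => rfl
      map_smul' := fun _ _ => rfl
      left_inv := fun _ => rfl
      right_inv := fun _ => rfl }

lemma topZ_dsum₂ {b c : Fin nv → ℕ} (X : RepPt s t b K) (Y : RepPt s t c K) :
    topZ (dsum₂ X Y) = topZ X + topZ Y := by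
  unfold topZ
  simp only [repMat_dsum₂, Matrix.rank_submatrix, rank_fromBlocks_diag, Nat.cast_add,
    Finset.sum_add_distrib]
  ring

lemma topZ_dsumList (l : List (RepSig s t K)) :
    topZ (dsumList l).2 = (l.map fun Y => topZ Y.2).sum := by
  induction l with
  | nil =>
    have : ∀ e, (repMat (zeroRep s t K) e).rank = 0 := fun e => by
      have := Matrix.rank_le_width (repMat (zeroRep s t K) e)
      omega
    change topZ (zeroRep s t K) = 0
    simp [topZ, this]
  | cons a l ih =>
    rw [List.map_cons, List.sum_cons, ← ih]
    exact topZ_dsum₂ _ _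

lemma exists_mul_mul_eq_one {m n : ℕ} (A : Matrix (Fin m) (Fin n) K) :
    ∃ (P : Matrix (Fin A.rank) (Fin m) K) (Q : Matrix (Fin n) (Fin A.rank) K),
      P * A * Q = 1 := by
  classical
  obtain ⟨f, hf⟩ : ∃ f, f = Matrix.toLin' A := ⟨_, rfl⟩
  obtain ⟨g, hg⟩ := f.rangeRestrict.exists_rightInverse_of_surjective f.range_rangeRestrict
  obtain ⟨p, hp⟩ := (LinearMap.range f).subtype.exists_leftInverse_of_injective
    (Submodule.ker_subtype _)
  have hrk : Module.finrank K (LinearMap.range f) = A.rank := by rw [hf]; rfl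
  let B : Module.Basis (Fin A.rank) K (LinearMap.range f) :=
    Module.finBasisOfFinrankEq K _ hrk
  clear_value B
  generalize A.rank = r at *
  refine ⟨LinearMap.toMatrix (Pi.basisFun K _) B p, LinearMap.toMatrix B (Pi.basisFun K _) g, ?_⟩
  have hL : A = LinearMap.toMatrix (Pi.basisFun K _) (Pi.basisFun K _) f := by
    rw [hf]
    exact (LinearMap.toMatrix'_toLin' A).symm
  rw [hL, ← LinearMap.toMatrix_comp, ← LinearMap.toMatrix_comp]
  have : (p ∘ₗ f) ∘ₗ g = LinearMap.id := by
    refine LinearMap.ext fun x => ?_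
    have h1 := LinearMap.congr_fun hg x
    have h2 := LinearMap.congr_fun hp (f.rangeRestrict (g x))
    simp only [LinearMap.comp_apply, LinearMap.id_apply] at h1 h2 ⊢
    exact h2.trans h1
  rw [this, LinearMap.toMatrix_id]

lemma rank_le_of_closure {b : Fin nv → ℕ} {X L : RepPt s t b K}
    (h : L ∈ closure (isoClass X)) (e : Fin ne) : (repMat L e).rank ≤ (repMat X e).rank := by
  classical
  -- P * L * Q = 1
  obtain ⟨P, Q, hPQ⟩ := exists_mul_mul_eq_one (repMat L e)
  let M : Matrix (Fin (b (t e))) (Fin (b (s e)))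
      (MvPolynomial ((e : Fin ne) × (Fin (b (t e)) × Fin (b (s e)))) K) :=
    Matrix.of fun p q => MvPolynomial.X ⟨e, (p, q)⟩
  let F := ((P.map (MvPolynomial.C : K →+* MvPolynomial
    ((e : Fin ne) × (Fin (b (t e)) × Fin (b (s e)))) K) : Matrix _ _ _) * M *
    (Q.map (MvPolynomial.C : K →+* MvPolynomial
    ((e : Fin ne) × (Fin (b (t e)) × Fin (b (s e)))) K) : Matrix _ _ _)).det
  have hF : ∀ ρ : RepPt s t b K, MvPolynomial.eval ρ F = (P * repMat ρ e * Q).det := by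
    intro ρ
    simp only [F]
    rw [RingHom.map_det]
    congr 1
    simp only [RingHom.mapMatrix_apply, Matrix.map_mul]
    congr 1
    · congr 1
      · ext i j; exact MvPolynomial.eval_C _
      · ext i j; exact MvPolynomial.eval_X _
    · ext i j; exact MvPolynomial.eval_C _
  have hopen : IsOpen {ρ : RepPt s t b K | MvPolynomial.eval ρ F ≠ 0} := by
    refine ⟨_, (PrimeSpectrum.basicOpen F).isOpen, ?_⟩
    ext ρ
    simp [RingHom.mem_ker]
    rfl
  obtain ⟨ρ, hρ, φ, hφ⟩ := mem_closure_iff.mp h _ hopen (by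
    show MvPolynomial.eval L F ≠ 0
    rw [hF, hPQ]; simp)
  rw [rank_of_iso hφ]
  change MvPolynomial.eval ρ F ≠ 0 at hρ
  rw [hF] at hρ
  have := Matrix.rank_of_det_ne_zero hρ
  rw [Fintype.card_fin] at this
  rw [← this]
  exact (Matrix.rank_mul_le_left _ _).trans (Matrix.rank_mul_le_right _ _)

lemma topZ_le_of_closure {b : Fin nv → ℕ} {X L : RepPt s t b K}
    (h : L ∈ closure (isoClass X)) : topZ X ≤ topZ L := by
  unfold topZ
  have : ∑ e, ((repMat L e).rank : ℤ) ≤ ∑ e, ((repMat X e).rank : ℤ) :=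
    Finset.sum_le_sum fun e _ => by exact_mod_cast rank_le_of_closure h e
  linarith

end helpers

section linearA

open scoped Matrix

variable {K : Type*} [Field K] {m : ℕ}

lemma one_le_topZ (X : RepSig (Fin.castSucc (n := m)) Fin.succ K)
    (hX : X.1 ≠ fun _ => 0) : 1 ≤ topZ X.2 := by
  classical
  have hex : ∃ i, X.1 i ≠ 0 := by
    by_contra hcon
    push Not at hcon
    exact hX (funext hcon)
  obtain ⟨i, hi, hmin⟩ := WellFounded.has_min (wellFounded_lt (α := Fin (m + 1)))
    {i | X.1 i ≠ 0} hex
  have hz : ∀ l, l < i → X.1 l = 0 := fun l hl => by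
    by_contra hcon; exact hmin l hcon hl
  unfold topZ
  rw [Fin.sum_univ_succ]
  have hr : ∀ e : Fin m, ((repMat X.2 e).rank : ℤ) ≤ X.1 e.succ := fun e => by
    exact_mod_cast Matrix.rank_le_height _
  have hr0 : ∀ e : Fin m, (repMat X.2 e).rank ≤ X.1 e.castSucc := fun e =>
    Matrix.rank_le_width _
  have hi : X.1 i ≠ 0 := hi
  induction i using Fin.cases with
  | zero =>
    have := Finset.sum_le_sum fun e (_ : e ∈ Finset.univ) => hr e
    omega
  | succ e0 =>
    have := Finset.sum_lt_sum (s := Finset.univ) (fun e _ => hr e) ⟨e0, Finset.mem_univ _, by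
      have h1 := hr0 e0
      have h2 := hz _ (Fin.castSucc_lt_succ (i := e0))
      omega⟩
    omega

lemma topZ_le_one (X : RepSig (Fin.castSucc (n := m)) Fin.succ K)
    (hX : IsIndec X) : topZ X.2 ≤ 1 := by
  classical
  have hex : ∃ i, X.1 i ≠ 0 := by
    by_contra hcon
    push Not at hcon
    exact hX.1 (funext hcon)
  obtain ⟨i, hi, hmin⟩ := WellFounded.has_min (wellFounded_lt (α := Fin (m + 1)))
    {i | X.1 i ≠ 0} hex
  have hi : X.1 i ≠ 0 := hi
  have hz : ∀ l, l < i → X.1 l = 0 := fun l hl => by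
    by_contra hcon; exact hmin l hcon hl
  have hzv : ∀ l, l < i → ∀ x : Fin (X.1 l) → K, x = 0 := fun l hl x => by
    have : IsEmpty (Fin (X.1 l)) := by rw [hz l hl]; infer_instance
    exact Subsingleton.elim _ _
  -- threads
  let thr : (∀ l, Fin (X.1 l) → K) → Prop := fun w =>
    ∀ e : Fin m, e.succ ≠ i → w e.succ = repMat X.2 e *ᵥ w e.castSucc
  obtain ⟨w0, hw0, hw0i⟩ : ∃ w, thr w ∧ w i ≠ 0 := by
    refine ⟨fun l => Fin.induction (motive := fun l => Fin (X.1 l) → K) (fun _ => 1)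
      (fun e x => if e.succ = i then fun _ => 1 else repMat X.2 e *ᵥ x) l, ?_, ?_⟩
    · intro e he
      simp [he]
    · have h1 : (fun _ => 1 : Fin (X.1 i) → K) ≠ 0 := fun h =>
        one_ne_zero (congrFun h ⟨0, Nat.pos_of_ne_zero hi⟩)
      convert h1 using 1
      clear * -
      induction i using Fin.cases <;> simp
  obtain ⟨j, ⟨w, hw, hwj⟩, hmax⟩ := WellFounded.has_min (wellFounded_gt (α := Fin (m + 1)))
    {j | ∃ w, thr w ∧ w j ≠ 0} ⟨i, w0, hw0, hw0i⟩
  have hmax : ∀ w, thr w → ∀ l, j < l → w l = 0 := fun w hw l hl => by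
    by_contra hcon; exact hmax l ⟨w, hw, hcon⟩ hl
  have hij : i ≤ j := by
    by_contra hcon
    exact hwj (hzv j (not_le.mp hcon) _)
  obtain ⟨p, hp⟩ : ∃ p, w j p ≠ 0 := by
    by_contra hcon
    push Not at hcon
    exact hwj (funext hcon)
  -- cothread (row vectors)
  obtain ⟨c, hcj, hcg, hc⟩ : ∃ c : ∀ l, Fin (X.1 l) → K, c j ⬝ᵥ w j = 1 ∧ (∀ l, j < l → c l = 0) ∧
      ∀ e : Fin m, e.castSucc ≠ j → c e.castSucc = c e.succ ᵥ* repMat X.2 e := by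
    let c : ∀ l, Fin (X.1 l) → K := fun l =>
      Fin.reverseInduction (motive := fun l => Fin (X.1 l) → K)
        (if h : Fin.last m = j then h ▸ Pi.single p (w j p)⁻¹ else 0)
        (fun e x => if h : e.castSucc = j then h ▸ Pi.single p (w j p)⁻¹ else x ᵥ* repMat X.2 e) l
    have c1 : c (Fin.last m) = if h : Fin.last m = j then h ▸ Pi.single p (w j p)⁻¹ else 0 := by
      simp [c]
    have c2 : ∀ e : Fin m, c e.castSucc = if h : e.castSucc = j then h ▸ Pi.single p (w j p)⁻¹
        else c e.succ ᵥ* repMat X.2 e := fun e => by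
      simp only [c]; rw [Fin.reverseInduction_castSucc]
    clear_value c
    refine ⟨c, ?_, ?_, ?_⟩
    · have : c j = Pi.single p (w j p)⁻¹ := by
        clear * - c1 c2
        induction j using Fin.lastCases with
        | last => simpa using c1
        | cast e => simpa using c2 e
      rw [this]
      simp [hp]
    · intro l
      induction l using Fin.reverseInduction with
      | last => intro h; rw [c1, dif_neg h.ne']
      | cast e ih =>
        intro h
        rw [c2, dif_neg h.ne', ih (h.trans Fin.castSucc_lt_succ), Matrix.zero_vecMul]
    · intro e he
      rw [c2, dif_neg he]
  have hcw : ∀ l, i ≤ l → l ≤ j → c l ⬝ᵥ w l = 1 := by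
    intro l
    induction l using Fin.reverseInduction with
    | last =>
      intro _ h
      have : Fin.last m = j := le_antisymm h (Fin.le_last _)
      rw [this]; exact hcj
    | cast e ih =>
      intro h1 h2
      by_cases hj : e.castSucc = j
      · rw [hj]; exact hcj
      · have h3 : e.succ ≤ j := Fin.castSucc_lt_iff_succ_le.mp (lt_of_le_of_ne h2 hj)
        have h4 : i < e.succ := lt_of_le_of_lt h1 Fin.castSucc_lt_succ
        rw [hc e hj, ← Matrix.dotProduct_mulVec, ← hw e h4.ne']
        exact ih h4.le h3
  have hdich : ∀ l, c l ⬝ᵥ w l = 1 ∨ w l = 0 := by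
    intro l
    by_cases h1 : i ≤ l
    · by_cases h2 : l ≤ j
      · exact Or.inl (hcw l h1 h2)
      · exact Or.inr (hmax w hw l (not_le.mp h2))
    · exact Or.inr (hzv l (not_le.mp h1) _)
  have key := indec_idem X hX (fun l => Matrix.vecMulVec (w l) (c l)) (by
    intro l
    rw [Matrix.vecMulVec_mul_vecMulVec]
    rcases hdich l with h | h
    · rw [h]; simp
    · simp [h]) (by
    intro e
    rw [Matrix.vecMulVec_mul, Matrix.mul_vecMulVec]
    by_cases hi' : e.succ = i
    · have : e.castSucc < i := hi' ▸ Fin.castSucc_lt_succ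
      have hE : IsEmpty (Fin (X.1 e.castSucc)) := by rw [hz _ this]; infer_instance
      ext p q
      exact hE.elim q
    · by_cases hj : e.castSucc = j
      · have hjl : j < e.succ := hj ▸ Fin.castSucc_lt_succ
        rw [← hw e hi', hmax w hw _ hjl]
        simp
      · rw [hw e hi', hc e hj])
  rcases key with key | key
  · exfalso
    have h1 := key j
    have h2 : Matrix.vecMulVec (w j) (c j) *ᵥ w j = 0 := by
      rw [h1, Matrix.zero_mulVec]
    rw [Matrix.vecMulVec_mulVec, hcj] at h2
    simp at h2
    exact hwj h2
  have hx : ∀ l (x : Fin (X.1 l) → K), (c l ⬝ᵥ x) • w l = x := fun l x => by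
    have := congrArg (fun M => M *ᵥ x) (key l)
    simp only [Matrix.vecMulVec_mulVec, Matrix.one_mulVec] at this
    simpa using this
  have hb1 : ∀ l, X.1 l ≤ 1 := fun l => by
    have := finrank_le_one (R := K) (w l) (fun x => ⟨_, hx l x⟩)
    simpa using this
  have hbr : ∀ e : Fin m, e.succ ≠ i → X.1 e.succ ≤ (repMat X.2 e).rank := fun e he => by
    have : LinearMap.range (repMat X.2 e).mulVecLin = ⊤ := by
      rw [LinearMap.range_eq_top]
      intro x
      refine ⟨(c e.succ ⬝ᵥ x) • w e.castSucc, ?_⟩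
      rw [map_smul, Matrix.mulVecLin_apply, ← hw e he, hx]
    unfold Matrix.rank
    rw [this]
    simp
  have hb0 : (X.1 0 : ℤ) ≤ if 0 = i then 1 else 0 := by
    split_ifs with h
    · exact_mod_cast hb1 0
    · rw [hz 0 (Fin.pos_of_ne_zero (Ne.symm h))]; simp
  have hbs : ∀ e : Fin m, (X.1 e.succ : ℤ) ≤ (if e.succ = i then 1 else 0) + (repMat X.2 e).rank := by
    intro e
    split_ifs with h
    · have := hb1 e.succ
      omega
    · have := hbr e h
      omega
  have hsum := Finset.sum_le_sum fun e (_ : e ∈ Finset.univ) => hbs e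
  rw [Finset.sum_add_distrib] at hsum
  have h1 : ∑ l : Fin (m + 1), (if l = i then (1 : ℤ) else 0) = 1 := by simp
  rw [Fin.sum_univ_succ] at h1
  unfold topZ
  rw [Fin.sum_univ_succ]
  linarith

end linearA

theorem degeneration_num_indec_summands_le
    {K : Type*} [Field K] [IsAlgClosed K] {m : ℕ}
    -- the linearly oriented `A`-type quiver `0 → 1 → ⋯ → m`
    (s : Fin m → Fin (m + 1)) (t : Fin m → Fin (m + 1))
    (hs : s = Fin.castSucc) (ht : t = Fin.succ)
    {b : Fin (m + 1) → ℕ} (X L : RepPt s t b K)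
    -- `L` is a degeneration of `X`
    (hdeg : L ∈ closure (isoClass X))
    -- decompositions of `X` and `L` into indecomposable summands
    (lX lL : List (RepSig s t K))
    (hlX : ∀ Y ∈ lX, IsIndec Y) (hlL : ∀ Y ∈ lL, IsIndec Y)
    (hX : ∃ φ, IsRepIso X (dsumList lX).2 φ)
    (hL : ∃ φ, IsRepIso L (dsumList lL).2 φ) :
    lX.length ≤ lL.length := by
  subst hs ht
  obtain ⟨φ, hφ⟩ := hX
  obtain ⟨ψ, hψ⟩ := hL
  have h1 := topZ_of_iso hφ
  have h2 := topZ_of_iso hψ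
  rw [topZ_dsumList] at h1 h2
  have h3 := topZ_le_of_closure hdeg
  have h4 := List.card_nsmul_le_sum (lX.map fun Y => topZ Y.2) 1 (by
    intro x hx
    obtain ⟨Y, hY, rfl⟩ := List.mem_map.mp hx
    exact one_le_topZ Y (hlX Y hY).1)
  have h5 := List.sum_le_card_nsmul (lL.map fun Y => topZ Y.2) 1 (by
    intro x hx
    obtain ⟨Y, hY, rfl⟩ := List.mem_map.mp hx
    exact topZ_le_one Y (hlL Y hY))
  simp only [List.length_map, nsmul_eq_mul, mul_one] at h4 h5
  omega
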